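/- arXiv:2502.14498 — 2 statements merged into one kernel-verified Lean document; each statement's English description precedes it below -/
import Mathlib

section
/- Let $m \in (0,1]$, let $\mathtt l < \mathtt r$ be reals, and let $M_p > 0$. Let $p : \mathbb R^2 \to [0,\infty)$ be measurable with $p(x,y) \le M_p$ for all $(x,y)$ and $\int_{\mathbb R} p(x,y)\,dy = 1$ for every $x \in \mathbb R$. Let $f : \mathbb R \to [0,\infty)$ be measurable with $f(x) > m$ for every $x \in [\mathtt l,\mathtt r]$, and set $s(x,y) := p(x,y) f(x)$. On a probability space $\Omega$, let $\widehat S : \Omega \times \mathbb R^2 \to \mathbb R$ and $\widehat F : \Omega \times \mathbb R \to \mathbb R$ be jointly measurable, and define $\widehat p(\omega; x,y) := \widehat S(\omega;x,y)/\widehat F(\omega;x)$ if $\widehat F(\omega;x) > m/2$, and $\widehat p(\omega; x,y) := 0$ otherwise. Then $$\mathbb E\Big(\int_{[\mathtt l,\mathtt r]\times\mathbb R} (\widehat p - p)^2\,dx\,dy\Big) \le \frac{8}{m^2}\max\{1, M_p\}\Big( \mathbb E\Big(\int_{[\mathtt l,\mathtt r]\times\mathbb R} (\widehat S - s)^2\,dx\,dy\Big)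 + 2\,\mathbb E\Big(\int_{\mathbb R} (\widehat F - f)^2\,dx\Big) \Big),$$ where all integrals and expectations in this inequality are those of nonnegative functions, with values in $[0,\infty]$. -/
open MeasureTheory
open scoped ENNReal

/-- The ratio estimator `(S(x,y) / F(x)) · 𝟙_{F(x) > m/2}` with numerator `S`, denominator `F`
and truncation level `m / 2`, as a function of `z = (x, y)`. -/
noncomputable def ratioEstimator (m : ℝ) (S : ℝ → ℝ → ℝ) (F : ℝ → ℝ) (z : ℝ × ℝ) : ℝ :=
  if m / 2 < F z.1 then S z.1 z.2 / F z.1 else 0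

/-- The squared `L²` norm `∫_A g²` of `g` restricted to `A`, for the Lebesgue measure,
as an element of `[0, ∞]`: it is `∞` when `g` is not square integrable on `A`. -/
noncomputable def sqNormOn {α : Type*} [MeasureSpace α] (A : Set α) (g : α → ℝ) : ℝ≥0∞ :=
  ∫⁻ z in A, ENNReal.ofReal (g z ^ 2)

/-- Pointwise error bound for the truncated ratio estimator, where `S`, `F`, `p`, `f` are the values
of the numerator, the denominator, the conditional density and the marginal density. -/
lemma ratio_sub_sq_le {m M S F p f : ℝ} (hm : 0 < m) (hp : 0 ≤ p) (hpM : p ≤ M) (hf : m < f) :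
    ((if m / 2 < F then S / F else 0) - p) ^ 2
      ≤ 8 / m ^ 2 * max 1 M * ((S - p * f) ^ 2 + p * (F - f) ^ 2) := by
  have hpp : p ^ 2 ≤ M * p := by nlinarith
  have key : ((if m / 2 < F then S / F else 0) - p) ^ 2
      ≤ 8 / m ^ 2 * ((S - p * f) ^ 2 + p ^ 2 * (F - f) ^ 2) := by
    rw [div_mul_eq_mul_div, le_div_iff₀ (by positivity)]
    split_ifs with h
    · have hF : 0 < F := by linarith
      have hmF : m ^ 2 ≤ 4 * F ^ 2 := by nlinarith
      have hsq : (S - p * F) ^ 2 ≤ 2 * ((S - p * f) ^ 2 + p ^ 2 * (F - f) ^ 2) := by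
        nlinarith [sq_nonneg ((S - p * f) + p * (F - f))]
      calc (S / F - p) ^ 2 * m ^ 2 ≤ (S / F - p) ^ 2 * (4 * F ^ 2) := by gcongr
        _ = 4 * (S - p * F) ^ 2 := by field_simp
        _ ≤ _ := by linarith
    · have hmf : m ^ 2 ≤ 4 * (F - f) ^ 2 := by nlinarith
      have := mul_le_mul_of_nonneg_left hmf (sq_nonneg p)
      nlinarith [sq_nonneg (S - p * f), mul_nonneg (sq_nonneg p) (sq_nonneg (F - f))]
  refine key.trans ?_
  rw [mul_assoc]
  refine mul_le_mul_of_nonneg_left ?_ (by positivity)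
  have h1 : (S - p * f) ^ 2 ≤ max 1 M * (S - p * f) ^ 2 :=
    le_mul_of_one_le_left (sq_nonneg _) (le_max_left _ _)
  have h2 : p ^ 2 * (F - f) ^ 2 ≤ max 1 M * (p * (F - f) ^ 2) := by
    rw [← mul_assoc]
    exact mul_le_mul_of_nonneg_right
      (hpp.trans (mul_le_mul_of_nonneg_right (le_max_right _ _) hp)) (sq_nonneg _)
  linarith

/-- Integrating out the second variable against a conditional density `p`. -/
lemma lintegral_conditional_density_mul {p : ℝ → ℝ → ℝ}
    (hpmeas : Measurable (fun z : ℝ × ℝ => p z.1 z.2)) (hpnonneg : ∀ x y, 0 ≤ p x y)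
    (hpdens : ∀ x, ∫ y, p x y = 1) {g : ℝ → ℝ≥0∞} (hg : Measurable g) (A : Set ℝ) :
    ∫⁻ z in A ×ˢ Set.univ, ENNReal.ofReal (p z.1 z.2) * g z.1 = ∫⁻ x in A, g x := by
  have hvol : (volume : Measure (ℝ × ℝ)).restrict (A ×ˢ Set.univ)
      = ((volume : Measure ℝ).restrict A).prod volume := by
    rw [Measure.volume_eq_prod, ← Measure.prod_restrict, Measure.restrict_univ]
  rw [hvol, lintegral_prod _ (by fun_prop)]
  refine lintegral_congr fun x => ?_
  have hx : Measurable (p x) := hpmeas.comp measurable_prodMk_left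
  dsimp only
  rw [lintegral_mul_const _ hx.ennreal_ofReal,
    ← ofReal_integral_eq_lintegral_ofReal (integrable_of_integral_eq_one (hpdens x))
      (Filter.Eventually.of_forall (hpnonneg x)), hpdens x, ENNReal.ofReal_one, one_mul]

theorem risk_bound_ratio_estimator
    {Ω : Type*} [MeasurableSpace Ω] (P : Measure Ω) [IsProbabilityMeasure P]
    (m : ℝ) (hm : m ∈ Set.Ioc (0 : ℝ) 1)
    (l r : ℝ) (hlr : l < r)
    (M_p : ℝ) (hMp : 0 < M_p)
    (p : ℝ → ℝ → ℝ) (hpmeas : Measurable (fun z : ℝ × ℝ => p z.1 z.2))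
    (hpnonneg : ∀ x y, 0 ≤ p x y) (hpbdd : ∀ x y, p x y ≤ M_p)
    (hpdens : ∀ x, ∫ y, p x y = 1)
    (f : ℝ → ℝ) (hfmeas : Measurable f) (hfnonneg : ∀ x, 0 ≤ f x)
    (hflow : ∀ x ∈ Set.Icc l r, m < f x)
    (Shat : Ω → ℝ → ℝ → ℝ)
    (hSmeas : Measurable (fun q : Ω × ℝ × ℝ => Shat q.1 q.2.1 q.2.2))
    (Fhat : Ω → ℝ → ℝ)
    (hFmeas : Measurable (fun q : Ω × ℝ => Fhat q.1 q.2)) :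
    ∫⁻ ω, sqNormOn (Set.Icc l r ×ˢ Set.univ)
        (fun z : ℝ × ℝ => ratioEstimator m (Shat ω) (Fhat ω) z - p z.1 z.2) ∂P
      ≤ ENNReal.ofReal (8 / m ^ 2 * max 1 M_p) *
        ((∫⁻ ω, sqNormOn (Set.Icc l r ×ˢ Set.univ)
            (fun z : ℝ × ℝ => Shat ω z.1 z.2 - p z.1 z.2 * f z.1) ∂P)
          + 2 * ∫⁻ ω, sqNormOn Set.univ (fun x : ℝ => Fhat ω x - f x) ∂P) := by
  have hm0 : 0 < m := hm.1
  have hC : 0 ≤ 8 / m ^ 2 * max 1 M_p := by positivity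
  have hErr : Measurable (fun q : Ω × ℝ × ℝ =>
      ENNReal.ofReal ((Shat q.1 q.2.1 q.2.2 - p q.2.1 q.2.2 * f q.2.1) ^ 2)) := by
    have : Measurable (fun q : Ω × ℝ × ℝ => p q.2.1 q.2.2) := hpmeas.comp measurable_snd
    exact ((hSmeas.sub (this.mul (by fun_prop))).pow_const 2).ennreal_ofReal
  have hErrNorm : Measurable (fun ω => sqNormOn (Set.Icc l r ×ˢ Set.univ)
      (fun z : ℝ × ℝ => Shat ω z.1 z.2 - p z.1 z.2 * f z.1)) :=
    hErr.lintegral_prod_right'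
  have hbound : ∀ ω, sqNormOn (Set.Icc l r ×ˢ Set.univ)
        (fun z : ℝ × ℝ => ratioEstimator m (Shat ω) (Fhat ω) z - p z.1 z.2)
      ≤ ENNReal.ofReal (8 / m ^ 2 * max 1 M_p) *
        (sqNormOn (Set.Icc l r ×ˢ Set.univ)
            (fun z : ℝ × ℝ => Shat ω z.1 z.2 - p z.1 z.2 * f z.1)
          + sqNormOn Set.univ (fun x : ℝ => Fhat ω x - f x)) := by
    intro ω
    have hF : Measurable (fun x => ENNReal.ofReal ((Fhat ω x - f x) ^ 2)) :=
      (((hFmeas.comp measurable_prodMk_left).sub hfmeas).pow_const 2).ennreal_ofReal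
    have hE : Measurable (fun z : ℝ × ℝ =>
        ENNReal.ofReal ((Shat ω z.1 z.2 - p z.1 z.2 * f z.1) ^ 2)) :=
      hErr.comp measurable_prodMk_left
    unfold sqNormOn
    calc _ ≤ ∫⁻ z in Set.Icc l r ×ˢ Set.univ, ENNReal.ofReal (8 / m ^ 2 * max 1 M_p) *
            (ENNReal.ofReal ((Shat ω z.1 z.2 - p z.1 z.2 * f z.1) ^ 2)
              + ENNReal.ofReal (p z.1 z.2) * ENNReal.ofReal ((Fhat ω z.1 - f z.1) ^ 2)) := by
          refine setLIntegral_mono' (measurableSet_Icc.prod MeasurableSet.univ) fun z hz => ?_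
          rw [← ENNReal.ofReal_mul (hpnonneg _ _), ← ENNReal.ofReal_add (sq_nonneg _)
            (mul_nonneg (hpnonneg _ _) (sq_nonneg _)), ← ENNReal.ofReal_mul hC]
          exact ENNReal.ofReal_le_ofReal
            (ratio_sub_sq_le hm0 (hpnonneg _ _) (hpbdd _ _) (hflow _ hz.1))
      _ = ENNReal.ofReal (8 / m ^ 2 * max 1 M_p) *
            ((∫⁻ z in Set.Icc l r ×ˢ Set.univ,
                ENNReal.ofReal ((Shat ω z.1 z.2 - p z.1 z.2 * f z.1) ^ 2))
              + ∫⁻ x in Set.Icc l r, ENNReal.ofReal ((Fhat ω x - f x) ^ 2)) := by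
          rw [lintegral_const_mul' _ _ ENNReal.ofReal_ne_top, lintegral_add_left hE,
            lintegral_conditional_density_mul hpmeas hpnonneg hpdens hF]
      _ ≤ _ := by
          gcongr
          exact Set.subset_univ _
  calc _ ≤ _ := lintegral_mono hbound
    _ = ENNReal.ofReal (8 / m ^ 2 * max 1 M_p) *
        ((∫⁻ ω, sqNormOn (Set.Icc l r ×ˢ Set.univ)
            (fun z : ℝ × ℝ => Shat ω z.1 z.2 - p z.1 z.2 * f z.1) ∂P)
          + ∫⁻ ω, sqNormOn Set.univ (fun x : ℝ => Fhat ω x - f x) ∂P) := by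
        rw [lintegral_const_mul' _ _ ENNReal.ofReal_ne_top,
          lintegral_add_left hErrNorm]
    _ ≤ _ := by
        gcongr
        exact le_mul_of_one_le_left zero_le one_le_two
end

section
/- Let $m\in(0,1]$, let $\mathtt l<\mathtt r$ be reals, and let $M_p>0$. Let $p:\mathbb R^2\to[0,\infty)$ be measurable with $p(x,y)\le M_p$ for all $(x,y)$ and $\int_{\mathbb R}p(x,y)\,dy=1$ for every $x\in\mathbb R$. Let $f:\mathbb R\to[0,\infty)$ be measurable with $f(x)>m$ for every $x\in[\mathtt l,\mathtt r]$, and set $s(x,y):=p(x,y)f(x)$. Let $S:\mathbb R^2\to\mathbb R$ and $F:\mathbb R\to\mathbb R$ be measurable, and define $\tilde p(x,y):=\frac{S(x,y)}{F(x)}\mathbf 1_{F(x)>m/2}$ (so $\tilde p(x,y)=0$ when $F(x)\le m/2$). Then, as an inequality in $[0,\infty]$ (each integral of a square and the Lebesgue measure below may be $+\infty$), $$\int_{[\mathtt l,\mathtt r]\times\mathbb R}(\tilde p-p)^2\,dx\,dy\le\frac{8}{m^2}\int_{[\mathtt l,\mathtt r]\times\mathbb R}(S-s)^2\,dx\,dy+\frac{8}{m^2}M_p\int_{\mathbb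 R}(F-f)^2\,dx+2M_p\,\mathrm{Leb}\{x\in\mathbb R:|f(x)-F(x)|>m/2\},$$ where $\mathrm{Leb}$ denotes Lebesgue measure. -/
open MeasureTheory

noncomputable section

/-- The truncated ratio `(S(x,y) / F(x)) · 𝟙_{F(x) > m/2}`. -/
def truncatedRatio (m : ℝ) (S : ℝ → ℝ → ℝ) (F : ℝ → ℝ) (x y : ℝ) : ℝ :=
  (S x y / F x) * Set.indicator {u : ℝ | m / 2 < F u} (fun _ => (1 : ℝ)) x

/-- `∫_{[l,r] × ℝ} g(x,y)² dx dy`, with values in `[0, ∞]`: the squared `L²`-norm of `g`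
restricted to the strip `[l,r] × ℝ` (it is `∞` when `g` is not square-integrable there). -/
def stripSqNorm (l r : ℝ) (g : ℝ → ℝ → ℝ) : ENNReal :=
  ∫⁻ z : ℝ × ℝ in Set.Icc l r ×ˢ Set.univ, ENNReal.ofReal (g z.1 z.2 ^ 2)

end

/-- Where the truncation is inactive, the error of the ratio splits into the numerator error and
the denominator error. -/
lemma sq_div_sub_le_of_half_lt {m M p f S F : ℝ} (hm : 0 < m) (hp : 0 ≤ p) (hpM : p ≤ M)
    (hF : m / 2 < F) :
    (S / F - p) ^ 2 ≤ 8 / m ^ 2 * (S - p * f) ^ 2 + 8 / m ^ 2 * M * (F - f) ^ 2 * p := by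
  have hF0 : 0 < F := by linarith
  have hinv : (F ^ 2)⁻¹ ≤ 4 / m ^ 2 := by
    rw [show 4 / m ^ 2 = ((m / 2) ^ 2)⁻¹ by field_simp; norm_num]
    gcongr
  have hsplit : S / F - p = ((S - p * f) + p * (f - F)) / F := by
    field_simp
    ring
  have hpp : p ^ 2 ≤ M * p := by nlinarith
  calc (S / F - p) ^ 2 = ((S - p * f) + p * (f - F)) ^ 2 * (F ^ 2)⁻¹ := by
        rw [hsplit, div_pow, div_eq_mul_inv]
    _ ≤ (2 * ((S - p * f) ^ 2 + p ^ 2 * (F - f) ^ 2)) * (4 / m ^ 2) := by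
        gcongr
        nlinarith [sq_nonneg ((S - p * f) - p * (f - F))]
    _ ≤ (2 * ((S - p * f) ^ 2 + M * p * (F - f) ^ 2)) * (4 / m ^ 2) := by gcongr
    _ = _ := by ring

/-- Pointwise error bound for the truncated ratio. -/
lemma ofReal_sq_truncatedRatio_sub_le {m M : ℝ} (hm : 0 < m) (S : ℝ → ℝ → ℝ) (F f : ℝ → ℝ)
    {x y p : ℝ} (hp : 0 ≤ p) (hpM : p ≤ M) (hf : m < f x) :
    ENNReal.ofReal ((truncatedRatio m S F x y - p) ^ 2)
      ≤ ENNReal.ofReal (8 / m ^ 2) * ENNReal.ofReal ((S x y - p * f x) ^ 2)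
        + (ENNReal.ofReal (8 / m ^ 2 * M) * ENNReal.ofReal ((F x - f x) ^ 2)
          + ENNReal.ofReal (2 * M) * {u : ℝ | m / 2 < |f u - F u|}.indicator 1 x)
          * ENNReal.ofReal p := by
  have hM : 0 ≤ M := hp.trans hpM
  by_cases hF : m / 2 < F x
  · have htr : truncatedRatio m S F x y = S x y / F x := by
      simp [truncatedRatio, hF]
    rw [htr]
    calc _ ≤ ENNReal.ofReal (8 / m ^ 2 * (S x y - p * f x) ^ 2
            + 8 / m ^ 2 * M * (F x - f x) ^ 2 * p) :=
          ENNReal.ofReal_le_ofReal (sq_div_sub_le_of_half_lt hm hp hpM hF)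
      _ = ENNReal.ofReal (8 / m ^ 2) * ENNReal.ofReal ((S x y - p * f x) ^ 2)
          + (ENNReal.ofReal (8 / m ^ 2 * M) * ENNReal.ofReal ((F x - f x) ^ 2))
            * ENNReal.ofReal p := by
          rw [ENNReal.ofReal_add (by positivity) (by positivity),
            ENNReal.ofReal_mul (by positivity),
            ENNReal.ofReal_mul (p := 8 / m ^ 2 * M * (F x - f x) ^ 2) (by positivity),
            ENNReal.ofReal_mul (p := 8 / m ^ 2 * M) (by positivity)]
      _ ≤ _ := by
          gcongr
          exact le_self_add
  · have htr : truncatedRatio m S F x y = 0 := by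
      simp [truncatedRatio, hF]
    have hmem : x ∈ {u : ℝ | m / 2 < |f u - F u|} :=
      lt_of_lt_of_le (by linarith) (le_abs_self (f x - F x))
    rw [htr, Set.indicator_of_mem hmem, Pi.one_apply, mul_one]
    calc _ ≤ ENNReal.ofReal (2 * M * p) := ENNReal.ofReal_le_ofReal (by nlinarith)
      _ = ENNReal.ofReal (2 * M) * ENNReal.ofReal p := ENNReal.ofReal_mul (by positivity)
      _ ≤ _ := le_add_left (by gcongr; exact le_add_self)

/-- A function of `x` weighted by a conditional density in `y` integrates to its own integral. -/
lemma lintegral_mul_conditional_density {p : ℝ → ℝ → ℝ}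
    (hpmeas : Measurable (fun z : ℝ × ℝ => p z.1 z.2)) (hpnonneg : ∀ x y, 0 ≤ p x y)
    (hpdens : ∀ x, ∫ y, p x y = 1) {G : ℝ → ENNReal} (hG : Measurable G) :
    ∫⁻ z : ℝ × ℝ, G z.1 * ENNReal.ofReal (p z.1 z.2) = ∫⁻ x, G x := by
  have hmeas : Measurable fun z : ℝ × ℝ => G z.1 * ENNReal.ofReal (p z.1 z.2) :=
    (hG.comp measurable_fst).mul hpmeas.ennreal_ofReal
  rw [Measure.volume_eq_prod, lintegral_prod _ hmeas.aemeasurable]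
  refine lintegral_congr fun x => ?_
  have hpx : Measurable (p x) := hpmeas.comp measurable_prodMk_left
  have hpint : Integrable (p x) := by
    by_contra h
    simpa [integral_undef h] using hpdens x
  dsimp only
  rw [lintegral_const_mul _ hpx.ennreal_ofReal,
    ← ofReal_integral_eq_lintegral_ofReal hpint (Filter.Eventually.of_forall (hpnonneg x)),
    hpdens x, ENNReal.ofReal_one, mul_one]

/-- All four terms take values in `[0, ∞]`; the inequality holds without any
integrability assumption on `S - s` or `F - f`. -/
theorem deterministic_decomposition_ratio_estimator
    (m : ℝ) (hm : m ∈ Set.Ioc (0 : ℝ) 1)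
    (l r : ℝ) (hlr : l < r)
    (M_p : ℝ) (hMp : 0 < M_p)
    (p : ℝ → ℝ → ℝ) (hpmeas : Measurable (fun z : ℝ × ℝ => p z.1 z.2))
    (hpnonneg : ∀ x y, 0 ≤ p x y) (hpbdd : ∀ x y, p x y ≤ M_p)
    (hpdens : ∀ x, ∫ y, p x y = 1)
    (f : ℝ → ℝ) (hfmeas : Measurable f) (hfnonneg : ∀ x, 0 ≤ f x)
    (hflow : ∀ x ∈ Set.Icc l r, m < f x)
    (s : ℝ → ℝ → ℝ) (hs : ∀ x y, s x y = p x y * f x)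
    (S : ℝ → ℝ → ℝ) (hSmeas : Measurable (fun z : ℝ × ℝ => S z.1 z.2))
    (F : ℝ → ℝ) (hFmeas : Measurable F) :
    stripSqNorm l r (fun x y => truncatedRatio m S F x y - p x y)
      ≤ ENNReal.ofReal (8 / m ^ 2) * stripSqNorm l r (fun x y => S x y - s x y)
        + ENNReal.ofReal (8 / m ^ 2 * M_p) * (∫⁻ x : ℝ, ENNReal.ofReal ((F x - f x) ^ 2))
        + ENNReal.ofReal (2 * M_p) * volume {x : ℝ | m / 2 < |f x - F x|} := by
  obtain rfl : s = fun x y => p x y * f x := funext₂ hs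
  have hA : MeasurableSet {x : ℝ | m / 2 < |f x - F x|} :=
    measurableSet_lt measurable_const (hfmeas.sub hFmeas).abs
  have hD : Measurable fun x => ENNReal.ofReal ((F x - f x) ^ 2) :=
    ((hFmeas.sub hfmeas).pow_const 2).ennreal_ofReal
  have hI : Measurable ({x : ℝ | m / 2 < |f x - F x|}.indicator (1 : ℝ → ENNReal)) :=
    measurable_one.indicator hA
  have hN : Measurable fun z : ℝ × ℝ =>
      ENNReal.ofReal ((S z.1 z.2 - p z.1 z.2 * f z.1) ^ 2) :=
    ((hSmeas.sub (hpmeas.mul (hfmeas.comp measurable_fst))).pow_const 2).ennreal_ofReal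
  set G : ℝ → ENNReal := fun x =>
    ENNReal.ofReal (8 / m ^ 2 * M_p) * ENNReal.ofReal ((F x - f x) ^ 2)
      + ENNReal.ofReal (2 * M_p) * {u : ℝ | m / 2 < |f u - F u|}.indicator 1 x with hGdef
  have hG : Measurable G := (hD.const_mul _).add (hI.const_mul _)
  have hGint : ∫⁻ x, G x
      = ENNReal.ofReal (8 / m ^ 2 * M_p) * (∫⁻ x : ℝ, ENNReal.ofReal ((F x - f x) ^ 2))
        + ENNReal.ofReal (2 * M_p) * volume {x : ℝ | m / 2 < |f x - F x|} := by
    rw [hGdef, lintegral_add_left (hD.const_mul _), lintegral_const_mul _ hD,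
      lintegral_const_mul _ hI, lintegral_indicator_one hA]
  rw [add_assoc, ← hGint, ← lintegral_mul_conditional_density hpmeas hpnonneg hpdens hG]
  unfold stripSqNorm
  calc _ ≤ ∫⁻ z : ℝ × ℝ in Set.Icc l r ×ˢ Set.univ,
        (ENNReal.ofReal (8 / m ^ 2) * ENNReal.ofReal ((S z.1 z.2 - p z.1 z.2 * f z.1) ^ 2)
          + G z.1 * ENNReal.ofReal (p z.1 z.2)) :=
        setLIntegral_mono' (measurableSet_Icc.prod MeasurableSet.univ) fun z hz =>
          ofReal_sq_truncatedRatio_sub_le hm.1 S F f (hpnonneg _ _) (hpbdd _ _) (hflow _ hz.1)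
    _ ≤ _ := by
        rw [lintegral_add_left (hN.const_mul _), lintegral_const_mul _ hN]
        gcongr
        exact Measure.restrict_le_self
end
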